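/- arXiv:1810.12213 — 2 statements merged into one kernel-verified Lean document; each statement's English description precedes it below -/
import Mathlib

section
/- The opposite of the category Int of intervals is equivalent to the augmented simplex category: there is an equivalence of categories Intᵒᵖ ≌ WithInitial SimplexCategory which sends the interval object 0 (the one-point interval [0]) to the initial object, and sends the interval object n with n ≥ 1 (the interval [n] with n+1 elements) to the simplex SimplexCategory.mk (n-1) (the linear order with n elements). -/
open CategoryTheory

/-- An interval map from `[n]` to `[m]`: a monotone function `Fin (n+1) → Fin (m+1)`
preserving the first and the last element. -/
@[ext]
structure IntervalMap (n m : ℕ) where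
  toFun : Fin (n+1) → Fin (m+1)
  mono : Monotone toFun
  map_zero : toFun 0 = 0
  map_last : toFun (Fin.last n) = Fin.last m

/-- The category of intervals: objects are natural numbers, where `n` stands for the
interval `[n]` with `n+1` elements, and morphisms are interval maps. -/
def Int' : Type := ℕ

instance : Category Int' where
  Hom n m := IntervalMap n m
  id n := ⟨id, monotone_id, rfl, rfl⟩
  comp f g := ⟨g.toFun ∘ f.toFun, g.mono.comp f.mono,
    by simp [f.map_zero, g.map_zero], by simp [f.map_last, g.map_last]⟩

/-- Interpret a natural number as an object of the category of intervals. -/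
def Int'.of (n : ℕ) : Int' := n

namespace IntervalMap

variable {n m : ℕ}

/-- Relates an interval map `[n] → [m]` to a monotone map between the sets `Fin m` and `Fin n` of
gaps of these intervals: `f` is lower adjoint to `g`. -/
def IsDual (f : IntervalMap n m) (g : Fin m →o Fin n) : Prop :=
  ∀ (i : Fin m) (j : Fin (n + 1)), (j : ℕ) ≤ g i ↔ (f.toFun j : ℕ) ≤ i

/-- The gap of `[n]` lying over the gap `i` of `[m]` under an interval map. -/
def dualFun (f : IntervalMap n m) (i : Fin m) : ℕ :=
  Nat.findGreatest (fun j ↦ ∃ h : j < n + 1, (f.toFun ⟨j, h⟩ : ℕ) ≤ i) n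

lemma le_dualFun_iff (f : IntervalMap n m) (i : Fin m) (j : Fin (n + 1)) :
    (j : ℕ) ≤ f.dualFun i ↔ (f.toFun j : ℕ) ≤ i := by
  refine ⟨fun h ↦ ?_, fun h ↦ Nat.le_findGreatest (Nat.le_of_lt_succ j.2) ⟨j.2, h⟩⟩
  obtain ⟨hlt, hle⟩ := Nat.findGreatest_spec
    (P := fun j ↦ ∃ h : j < n + 1, (f.toFun ⟨j, h⟩ : ℕ) ≤ i) (Nat.zero_le n)
    ⟨n.succ_pos, by simp [f.map_zero]⟩
  exact le_trans (f.mono (show j ≤ ⟨_, hlt⟩ from h)) hle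

lemma dualFun_lt (f : IntervalMap n m) (i : Fin m) : f.dualFun i < n := by
  by_contra! h
  have := (f.le_dualFun_iff i (Fin.last n)).1 h
  rw [f.map_last, Fin.val_last] at this
  exact absurd i.2 this.not_gt

/-- The monotone map between sets of gaps induced by an interval map. -/
def dual (f : IntervalMap n m) : Fin m →o Fin n where
  toFun i := ⟨f.dualFun i, f.dualFun_lt i⟩
  monotone' i i' h := by
    have hi := (f.le_dualFun_iff i ⟨_, (f.dualFun_lt i).trans n.lt_succ_self⟩).1 le_rfl
    exact (f.le_dualFun_iff i' ⟨_, (f.dualFun_lt i).trans n.lt_succ_self⟩).2 (hi.trans h)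

lemma isDual_dual (f : IntervalMap n m) : f.IsDual f.dual :=
  f.le_dualFun_iff

lemma IsDual.right_unique {f : IntervalMap n m} {g g' : Fin m →o Fin n}
    (h : f.IsDual g) (h' : f.IsDual g') : g = g' := by
  ext i
  exact le_antisymm
    ((h' i (g i).castSucc).2 ((h i (g i).castSucc).1 le_rfl))
    ((h i (g' i).castSucc).2 ((h' i (g' i).castSucc).1 le_rfl))

lemma IsDual.le {f f' : IntervalMap n m} {g : Fin m →o Fin n}
    (h : f.IsDual g) (h' : f'.IsDual g) (j : Fin (n + 1)) : f.toFun j ≤ f'.toFun j := by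
  by_cases hj : (f'.toFun j : ℕ) < m
  · exact (h ⟨_, hj⟩ j).1 ((h' ⟨_, hj⟩ j).2 le_rfl)
  · exact Fin.le_def.2 ((Nat.le_of_lt_succ (f.toFun j).2).trans (not_lt.1 hj))

lemma IsDual.left_unique {f f' : IntervalMap n m} {g : Fin m →o Fin n}
    (h : f.IsDual g) (h' : f'.IsDual g) : f = f' :=
  IntervalMap.ext (funext fun j ↦ le_antisymm (h.le h' j) (h'.le h j))

lemma dual_injective : Function.Injective (dual : IntervalMap n m → _) := fun f f' h ↦
  f.isDual_dual.left_unique (h ▸ f'.isDual_dual)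

lemma exists_isDual (g : Fin m →o Fin n) : ∃ f : IntervalMap n m, f.IsDual g := by
  have key (j : Fin (n + 1)) :
      ∃ a : Fin (m + 1), ∀ i : Fin m, (j : ℕ) ≤ g i ↔ (a : ℕ) ≤ i := by
    classical
    have ex : ∃ i, ∀ h : i < m, (j : ℕ) ≤ g ⟨i, h⟩ := ⟨m, fun h ↦ absurd h (lt_irrefl _)⟩
    refine ⟨⟨Nat.find ex, Nat.lt_succ_of_le (Nat.find_min' ex fun h ↦ absurd h (lt_irrefl _))⟩,
      fun i ↦ ⟨fun h ↦ Nat.find_min' ex fun _ ↦ h, fun h ↦ ?_⟩⟩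
    exact (Nat.find_spec ex (lt_of_le_of_lt h i.2)).trans (g.monotone (Fin.le_def.2 h))
  choose a ha using key
  refine ⟨⟨a, fun j j' h ↦ ?_, ?_, ?_⟩, fun i j ↦ ha j i⟩
  · by_contra! hlt
    have hm : (a j' : ℕ) < m := lt_of_lt_of_le hlt (Nat.le_of_lt_succ (a j).2)
    exact absurd ((ha j ⟨_, hm⟩).1 (le_trans h ((ha j' ⟨_, hm⟩).2 le_rfl))) (not_le.2 hlt)
  · by_contra h0
    have hpos : 0 < (a 0 : ℕ) := Fin.pos_iff_ne_zero.2 h0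
    have hm : 0 < m := lt_of_lt_of_le hpos (Nat.le_of_lt_succ (a 0).2)
    exact absurd ((ha 0 ⟨0, hm⟩).1 (Nat.zero_le _)) (not_le.2 hpos)
  · by_contra hne
    have hm : (a (Fin.last n) : ℕ) < m := Fin.lt_last_iff_ne_last.2 hne
    exact absurd ((ha (Fin.last n) ⟨_, hm⟩).2 le_rfl) (not_le.2 (g _).2)

lemma dual_surjective : Function.Surjective (dual : IntervalMap n m → _) := fun g ↦
  let ⟨f, hf⟩ := exists_isDual g
  ⟨f, f.isDual_dual.right_unique hf⟩

lemma dual_id (n : ℕ) : dual (n := n) (m := n) (𝟙 (Int'.of n)) = OrderHom.id :=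
  (isDual_dual _).right_unique fun _ _ ↦ Iff.rfl

lemma dual_comp {n m k : ℕ} (f : Int'.of n ⟶ Int'.of m) (f' : Int'.of m ⟶ Int'.of k) :
    dual (n := n) (m := k) (f ≫ f') =
      (dual (n := n) (m := m) f).comp (dual (n := m) (m := k) f') :=
  (isDual_dual (n := n) (m := k) (f ≫ f')).right_unique fun i j ↦
    (isDual_dual f (dual f' i) j).trans (isDual_dual f' i (f.toFun j))

end IntervalMap

namespace AugmentedSimplexCategory

/-- The linear order with `n` elements as an object of the augmented simplex category. -/
def ofCard : ℕ → WithInitial SimplexCategory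
  | 0 => WithInitial.star
  | n + 1 => WithInitial.of (SimplexCategory.mk n)

/-- The morphism of the augmented simplex category given by a monotone map. -/
def homOfOrderHom : ∀ {n m : ℕ}, (Fin n →o Fin m) → (ofCard n ⟶ ofCard m)
  | 0, m, _ => WithInitial.starInitial.to (ofCard m)
  | _ + 1, 0, g => (g 0).elim0
  | _ + 1, _ + 1, g => WithInitial.incl.map (SimplexCategory.mkHom g)

lemma homOfOrderHom_id : ∀ n : ℕ, homOfOrderHom (OrderHom.id : Fin n →o Fin n) = 𝟙 (ofCard n)
  | 0 => WithInitial.starInitial.hom_ext _ _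
  | n + 1 => WithInitial.incl.map_id (SimplexCategory.mk n)

lemma homOfOrderHom_comp : ∀ {n m k : ℕ} (g : Fin n →o Fin m) (g' : Fin m →o Fin k),
    homOfOrderHom (g'.comp g) = homOfOrderHom g ≫ homOfOrderHom g'
  | 0, _, _, _, _ => WithInitial.starInitial.hom_ext _ _
  | _ + 1, 0, _, g, _ => (g 0).elim0
  | _ + 1, _ + 1, 0, _, g' => (g' 0).elim0
  | _ + 1, _ + 1, _ + 1, g, g' =>
    WithInitial.incl.map_comp (SimplexCategory.mkHom g) (SimplexCategory.mkHom g')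

lemma homOfOrderHom_bijective : ∀ {n m : ℕ},
    Function.Bijective (homOfOrderHom : (Fin n →o Fin m) → _)
  | 0, _ => ⟨fun _ _ _ ↦ OrderHom.ext _ _ (Subsingleton.elim _ _),
      fun _ ↦ ⟨⟨Fin.elim0, fun i ↦ i.elim0⟩, WithInitial.starInitial.hom_ext _ _⟩⟩
  | _ + 1, 0 => ⟨fun g ↦ (g 0).elim0, fun f ↦ (WithInitial.false_of_to_star f).elim⟩
  | n + 1, m + 1 => by
    refine ⟨fun g g' h ↦ ?_, fun f ↦ ?_⟩
    · exact congrArg SimplexCategory.Hom.toOrderHom (WithInitial.incl.map_injective h)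
    · obtain ⟨g, hg⟩ := (WithInitial.incl (C := SimplexCategory)).map_surjective
        (X := SimplexCategory.mk n) (Y := SimplexCategory.mk m) f
      exact ⟨g.toOrderHom, hg⟩

end AugmentedSimplexCategory

open AugmentedSimplexCategory

namespace Int'

/-- The functor sending an interval to the linear order of its gaps. -/
def gaps : Int'ᵒᵖ ⥤ WithInitial SimplexCategory where
  obj n := ofCard n.unop
  map f := homOfOrderHom (IntervalMap.dual f.unop)
  map_id n := (congrArg homOfOrderHom (IntervalMap.dual_id n.unop)).trans (homOfOrderHom_id _)
  map_comp f g := (congrArg homOfOrderHom (IntervalMap.dual_comp g.unop f.unop)).trans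
    (homOfOrderHom_comp _ _)

instance : gaps.Faithful where
  map_injective h :=
    Quiver.Hom.unop_inj (IntervalMap.dual_injective (homOfOrderHom_bijective.1 h))

instance : gaps.Full where
  map_surjective f := by
    obtain ⟨g, rfl⟩ := homOfOrderHom_bijective.2 f
    obtain ⟨f, rfl⟩ := IntervalMap.dual_surjective g
    exact ⟨Quiver.Hom.op (V := Int') f, rfl⟩

instance : gaps.EssSurj where
  mem_essImage
    | .star => ⟨Opposite.op (Int'.of 0), ⟨Iso.refl _⟩⟩
    | .of X => ⟨Opposite.op (Int'.of (X.len + 1)), ⟨Iso.refl _⟩⟩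

instance : gaps.IsEquivalence where

end Int'

theorem int_op_equiv_augmented_simplex :
    ∃ e : Int'ᵒᵖ ≌ WithInitial SimplexCategory,
      e.functor.obj (Opposite.op (Int'.of 0)) = WithInitial.star ∧
      ∀ n : ℕ, 1 ≤ n →
        e.functor.obj (Opposite.op (Int'.of n)) = WithInitial.of (SimplexCategory.mk (n-1)) := by
  refine ⟨Int'.gaps.asEquivalence, rfl, fun n hn ↦ ?_⟩
  obtain ⟨n, rfl⟩ := Nat.exists_eq_add_of_le' hn
  rfl
end

section
/- Shuffles of [n] and [m] are equivalently described by their jump sets: the map sending a shuffle (r, s) of [n] and [m] to the finset {i : Fin (n+m) | r i.succ ≠ r i.castSucc} is a bijection from the set of shuffles of [n] and [m] onto the set of finsets A : Finset (Fin (n+m)) with A.card = n. -/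
/-- A shuffle of `[n]` and `[m]`: a pair of monotone maps `r`, `s` whose values
sum to the index. -/
structure Shuffle (n m : ℕ) where
  r : Fin (n+m+1) → Fin (n+1)
  s : Fin (n+m+1) → Fin (m+1)
  mono_r : Monotone r
  mono_s : Monotone s
  sum : ∀ i : Fin (n+m+1), (r i : ℕ) + (s i : ℕ) = (i : ℕ)

/-- The number of elements of `A` whose value is less than `k`. -/
def countBelow {N : ℕ} (A : Finset (Fin N)) (k : ℕ) : ℕ :=
  (A.filter fun a : Fin N => (a : ℕ) < k).card

section countBelow

variable {N : ℕ} (A : Finset (Fin N))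

lemma countBelow_zero : countBelow A 0 = 0 := by
  simp [countBelow]

lemma countBelow_self : countBelow A N = A.card := by
  simp [countBelow]

lemma countBelow_mono : Monotone (countBelow A) := fun _ _ hkl =>
  Finset.card_le_card <| Finset.monotone_filter_right A fun _ _ ha => lt_of_lt_of_le ha hkl

lemma countBelow_le_card (k : ℕ) : countBelow A k ≤ A.card :=
  Finset.card_filter_le _ _

lemma countBelow_succ (i : Fin N) :
    countBelow A (i + 1) = countBelow A i + if i ∈ A then 1 else 0 := by
  unfold countBelow
  split_ifs with hi
  · rw [← Finset.card_insert_of_notMem (a := i) (by simp)]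
    congr 1
    ext a
    simp only [Finset.mem_filter, Finset.mem_insert, Fin.ext_iff]
    constructor
    · rintro ⟨ha, h⟩
      by_cases hai : (a : ℕ) = i
      · exact Or.inl hai
      · exact Or.inr ⟨ha, by omega⟩
    · rintro (h | ⟨ha, h⟩)
      · exact ⟨Fin.ext h ▸ hi, by omega⟩
      · exact ⟨ha, by omega⟩
  · rw [add_zero]
    congr 1
    refine Finset.filter_congr fun a ha => ?_
    have : (a : ℕ) ≠ i := fun h => hi (Fin.ext h ▸ ha)
    omega

lemma countBelow_add_countBelow_compl (i : Fin (N + 1)) :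
    countBelow A i + countBelow Aᶜ i = i := by
  induction i using Fin.induction with
  | zero => simp [countBelow_zero]
  | succ i ih =>
    rw [Fin.val_castSucc] at ih
    rw [Fin.val_succ, countBelow_succ, countBelow_succ]
    by_cases hi : i ∈ A <;> simp [hi] <;> omega

end countBelow

namespace Shuffle

variable {n m : ℕ}

/-- The set of positions at which the first component of a shuffle jumps. -/
def jumpSet (sh : Shuffle n m) : Finset (Fin (n+m)) :=
  Finset.univ.filter fun i => sh.r i.succ ≠ sh.r i.castSucc

lemma r_eq_countBelow_jumpSet (sh : Shuffle n m) (i : Fin (n+m+1)) :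
    (sh.r i : ℕ) = countBelow sh.jumpSet i := by
  induction i using Fin.induction with
  | zero =>
    have := sh.sum 0
    rw [Fin.val_zero] at this ⊢
    rw [countBelow_zero]
    omega
  | succ i ih =>
    rw [Fin.val_castSucc] at ih
    rw [Fin.val_succ, countBelow_succ, ← ih]
    have h₀ := sh.sum i.castSucc
    have h₁ := sh.sum i.succ
    have hr : (sh.r i.castSucc : ℕ) ≤ sh.r i.succ := sh.mono_r i.castSucc_lt_succ.le
    have hs : (sh.s i.castSucc : ℕ) ≤ sh.s i.succ := sh.mono_s i.castSucc_lt_succ.le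
    rw [Fin.val_castSucc] at h₀
    rw [Fin.val_succ] at h₁
    simp only [jumpSet, Finset.mem_filter, Finset.mem_univ, true_and, ne_eq, Fin.ext_iff]
    split_ifs <;> omega

lemma card_jumpSet (sh : Shuffle n m) : sh.jumpSet.card = n := by
  have h := sh.r_eq_countBelow_jumpSet (Fin.last _)
  have hsum := sh.sum (Fin.last _)
  rw [Fin.val_last] at h hsum
  rw [countBelow_self] at h
  omega

lemma jumpSet_injective : Function.Injective (jumpSet : Shuffle n m → _) := by
  intro sh sh' h
  have hr (i) : (sh.r i : ℕ) = sh'.r i := by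
    rw [r_eq_countBelow_jumpSet, r_eq_countBelow_jumpSet, h]
  have hs (i) : (sh.s i : ℕ) = sh'.s i := by
    have := sh.sum i
    have := sh'.sum i
    have := hr i
    omega
  have hr' : sh.r = sh'.r := funext fun i => Fin.ext (hr i)
  have hs' : sh.s = sh'.s := funext fun i => Fin.ext (hs i)
  cases sh
  cases sh'
  simp_all

/-- The shuffle whose first component jumps exactly at the elements of `A`. -/
def ofJumpSet (A : Finset (Fin (n+m))) (hA : A.card = n) : Shuffle n m where
  r i := ⟨countBelow A i, Nat.lt_succ_of_le ((countBelow_le_card A i).trans_eq hA)⟩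
  s i := ⟨countBelow Aᶜ i, by
    have h := countBelow_le_card Aᶜ i
    rw [Finset.card_compl, Fintype.card_fin, hA] at h
    omega⟩
  mono_r _ _ h := countBelow_mono A h
  mono_s _ _ h := countBelow_mono Aᶜ h
  sum i := countBelow_add_countBelow_compl A i

lemma jumpSet_ofJumpSet (A : Finset (Fin (n+m))) (hA : A.card = n) :
    (ofJumpSet A hA).jumpSet = A := by
  ext i
  simp [jumpSet, ofJumpSet, countBelow_succ]

end Shuffle

theorem shuffle_jump_set_bijection (n m : ℕ) :
    Set.BijOn
      (fun sh : Shuffle n m =>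
        Finset.univ.filter (fun i : Fin (n+m) => sh.r i.succ ≠ sh.r i.castSucc))
      Set.univ
      {A : Finset (Fin (n+m)) | A.card = n} :=
  ⟨fun sh _ => sh.card_jumpSet, Shuffle.jumpSet_injective.injOn,
    fun A hA => ⟨Shuffle.ofJumpSet A hA, Set.mem_univ _, Shuffle.jumpSet_ofJumpSet A hA⟩⟩
end
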